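/- arXiv:2512.12883 — 4 statements merged into one kernel-verified Lean document; each statement's English description precedes it below -/
import Mathlib

section
/- Let h : [0,1]^b → ℝ be continuous, and suppose that for each coordinate index i and each fixed choice of the other coordinates, the map v_i ↦ h(v) is concave on [0,1]. Then h attains its minimum over the cube [0,1]^b at some binary vector v ∈ {0,1}^b. -/
/-- A function on the unit cube that is concave in each coordinate does not increase under a
suitable rounding of the coordinates in `s` to `0` or `1`. -/
theorem exists_binary_on_le_of_coordinatewise_concave {ι : Type*} [DecidableEq ι]
    {h : (ι → ℝ) → ℝ}
    (hconc : ∀ (i : ι) (v : ι → ℝ), (∀ j, v j ∈ Set.Icc (0 : ℝ) 1) →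
      ConcaveOn ℝ (Set.Icc (0 : ℝ) 1) (fun t => h (Function.update v i t)))
    {v : ι → ℝ} (hv : ∀ i, v i ∈ Set.Icc (0 : ℝ) 1) (s : Finset ι) :
    ∃ w : ι → ℝ, (∀ i, w i ∈ Set.Icc (0 : ℝ) 1) ∧ (∀ i ∈ s, w i = 0 ∨ w i = 1) ∧ h w ≤ h v := by
  induction s using Finset.induction_on with
  | empty => exact ⟨v, hv, by simp, le_rfl⟩
  | insert a s _ ih =>
    obtain ⟨w, hw, hws, hwv⟩ := ih
    have key : min (h (Function.update w a 0)) (h (Function.update w a 1)) ≤ h w := by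
      simpa using (hconc a w hw).min_le_of_mem_Icc (by simp) (by simp) (hw a)
    obtain ⟨t, ht, htw⟩ : ∃ t : ℝ, (t = 0 ∨ t = 1) ∧ h (Function.update w a t) ≤ h w := by
      rcases min_le_iff.mp key with h0 | h1
      · exact ⟨0, Or.inl rfl, h0⟩
      · exact ⟨1, Or.inr rfl, h1⟩
    refine ⟨Function.update w a t, fun i => ?_, fun i hi => ?_, htw.trans hwv⟩
    · rcases eq_or_ne i a with rfl | hia
      · rcases ht with rfl | rfl <;> simp
      · simpa [hia] using hw i
    · rcases eq_or_ne i a with rfl | hia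
      · simpa using ht
      · simpa [hia] using hws i (Finset.mem_of_mem_insert_of_ne hi hia)

/-- A continuous function on the unit cube [0,1]^b that is concave in each
coordinate separately attains its minimum over the cube at a binary vector in {0,1}^b. -/
theorem coordinatewise_concave_min_at_binary (b : ℕ)
    (h : (Fin b → ℝ) → ℝ)
    (hcont : ContinuousOn h {v : Fin b → ℝ | ∀ i, v i ∈ Set.Icc (0 : ℝ) 1})
    (hconc : ∀ (i : Fin b) (v : Fin b → ℝ),
      (∀ j, v j ∈ Set.Icc (0 : ℝ) 1) →
        ConcaveOn ℝ (Set.Icc (0 : ℝ) 1) (fun t => h (Function.update v i t))) :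
    ∃ v' : Fin b → ℝ, (∀ i, v' i = 0 ∨ v' i = 1) ∧
      ∀ v, (∀ i, v i ∈ Set.Icc (0 : ℝ) 1) → h v' ≤ h v := by
  obtain ⟨c, hc⟩ := Finite.exists_min fun c : Fin b → Bool => h fun i => if c i then 1 else 0
  refine ⟨fun i => if c i then 1 else 0, fun i => by cases c i <;> simp, fun v hv => ?_⟩
  obtain ⟨w, -, hw, hwv⟩ :=
    exists_binary_on_le_of_coordinatewise_concave hconc hv Finset.univ
  have hw_eq : (fun i => if decide (w i = 1) then (1 : ℝ) else 0) = w := by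
    funext i
    rcases hw i (Finset.mem_univ i) with hi | hi <;> simp [hi]
  have hcw := hc fun i => decide (w i = 1)
  rw [hw_eq] at hcw
  exact hcw.trans hwv
end

section
/- Let b be a positive integer, M an integer with 2^{b−1} < M ≤ 2^b, and α, β ≥ 0. If v ∈ {0,1}^b is a binary vector whose decoded index q := Σ_{i=0}^{b−1} 2^i v_i satisfies q ≤ M − 1, then the auxiliary penalty L_M(v) := α·Σ_{i=0}^{b−1} v_i(1 − v_i) + β·Σ_{k=M}^{2^b−1} ∏_{i : k_i = 1} v_i equals 0. -/
open Finset in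
/-- The auxiliary penalty function
`L_M(v) = α·Σᵢ vᵢ(1 − vᵢ) + β·Σ_{k=M}^{2^b−1} ∏_{i : kᵢ = 1} vᵢ`,
where `kᵢ = (k / 2^i) % 2` is the i-th binary digit of `k`. -/
noncomputable def LM (b M : ℕ) (α β : ℝ) (v : Fin b → ℝ) : ℝ :=
  α * ∑ i : Fin b, v i * (1 - v i) +
    β * ∑ k ∈ Finset.Ico M (2 ^ b),
      ∏ i ∈ Finset.univ.filter (fun i : Fin b => (k / 2 ^ (i : ℕ)) % 2 = 1), v i

/-- The first `n` binary digits of `k` add up to `k % 2 ^ n`. -/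
theorem sum_range_two_pow_mul_digit (k n : ℕ) :
    ∑ i ∈ Finset.range n, 2 ^ i * (k / 2 ^ i % 2) = k % 2 ^ n := by
  induction n with
  | zero => simp [Nat.mod_one]
  | succ n ih => rw [Finset.sum_range_succ, ih, Nat.mod_pow_succ]

/-- A number `k < 2 ^ b` is bounded by the index decoded from any nonnegative vector whose entries
are at least `1` on the support of the binary digits of `k`. -/
theorem le_sum_two_pow_mul_of_digit_support {b k : ℕ} (hk : k < 2 ^ b) {v : Fin b → ℝ}
    (hv : ∀ i, 0 ≤ v i) (hkv : ∀ i : Fin b, k / 2 ^ (i : ℕ) % 2 = 1 → 1 ≤ v i) :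
    (k : ℝ) ≤ ∑ i : Fin b, 2 ^ (i : ℕ) * v i := by
  have hsum : ∑ i : Fin b, 2 ^ (i : ℕ) * (k / 2 ^ (i : ℕ) % 2) = k := by
    rw [Fin.sum_univ_eq_sum_range (fun i => 2 ^ i * (k / 2 ^ i % 2)),
      sum_range_two_pow_mul_digit, Nat.mod_eq_of_lt hk]
  calc (k : ℝ) = ((∑ i : Fin b, 2 ^ (i : ℕ) * (k / 2 ^ (i : ℕ) % 2) : ℕ) : ℝ) := by rw [hsum]
    _ = ∑ i : Fin b, 2 ^ (i : ℕ) * ((k / 2 ^ (i : ℕ) % 2 : ℕ) : ℝ) := by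
      simp only [Nat.cast_sum, Nat.cast_mul, Nat.cast_pow, Nat.cast_ofNat]
    _ ≤ _ := by
      refine Finset.sum_le_sum fun i _ => mul_le_mul_of_nonneg_left ?_ (by positivity)
      rcases Nat.mod_two_eq_zero_or_one (k / 2 ^ (i : ℕ)) with h | h
      · simpa [h] using hv i
      · simpa [h] using hkv i h

/-- the auxiliary penalty vanishes at every binary vector whose decoded
index `q = Σᵢ 2^i vᵢ` satisfies `q ≤ M − 1`. -/
theorem LM_eq_zero_of_valid_binary (b M : ℕ) (hb : 0 < b)
    (hM₁ : 2 ^ (b - 1) < M) (hM₂ : M ≤ 2 ^ b)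
    (α β : ℝ) (hα : 0 ≤ α) (hβ : 0 ≤ β)
    (v : Fin b → ℝ) (hv : ∀ i, v i = 0 ∨ v i = 1)
    (hq : (∑ i : Fin b, 2 ^ (i : ℕ) * v i) ≤ (M : ℝ) - 1) :
    LM b M α β v = 0 := by
  have hpen : ∑ i : Fin b, v i * (1 - v i) = 0 :=
    Finset.sum_eq_zero fun i _ => by rcases hv i with h | h <;> simp [h]
  have hprod : ∑ k ∈ Finset.Ico M (2 ^ b),
      ∏ i ∈ Finset.univ.filter (fun i : Fin b => (k / 2 ^ (i : ℕ)) % 2 = 1), v i = 0 := by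
    refine Finset.sum_eq_zero fun k hk => ?_
    obtain ⟨hMk, hkb⟩ := Finset.mem_Ico.mp hk
    by_contra hne
    rw [← ne_eq, Finset.prod_ne_zero_iff] at hne
    have hle : (k : ℝ) ≤ ∑ i : Fin b, 2 ^ (i : ℕ) * v i := by
      refine le_sum_two_pow_mul_of_digit_support hkb
        (fun i => by rcases hv i with h | h <;> simp [h]) fun i hi => ?_
      exact ((hv i).resolve_left (hne i (by simp [hi]))).ge
    have hMk' : (M : ℝ) ≤ k := by exact_mod_cast hMk
    linarith
  rw [LM, hpen, hprod, mul_zero, mul_zero, add_zero]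
end

section
/- Let b be a positive integer, M an integer with 2^{b−1} < M ≤ 2^b, α ≥ 0 and β > 0. If v ∈ {0,1}^b is a binary vector whose decoded index q := Σ_{i=0}^{b−1} 2^i v_i satisfies q ≥ M, then the auxiliary penalty L_M(v) := α·Σ_{i=0}^{b−1} v_i(1 − v_i) + β·Σ_{k=M}^{2^b−1} ∏_{i : k_i = 1} v_i is strictly positive. -/
/-- The decoded index `∑ᵢ 2^i bᵢ` of a bit vector is `Nat.ofBits`. -/
theorem sum_two_pow_mul_toNat_eq_ofBits {n : ℕ} (f : Fin n → Bool) :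
    ∑ i : Fin n, 2 ^ (i : ℕ) * (f i).toNat = Nat.ofBits f := by
  induction n with
  | zero => simp
  | succ n ih =>
    rw [Nat.ofBits_succ, ← ih, Fin.sum_univ_succ, Finset.mul_sum]
    simp [pow_succ', mul_assoc, add_comm]

/-- the auxiliary penalty is strictly positive at every binary vector
whose decoded index `q = Σᵢ 2^i vᵢ` satisfies `q ≥ M`. -/
theorem LM_pos_of_invalid_binary (b M : ℕ) (hb : 0 < b)
    (hM₁ : 2 ^ (b - 1) < M) (hM₂ : M ≤ 2 ^ b)
    (α β : ℝ) (hα : 0 ≤ α) (hβ : 0 < β)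
    (v : Fin b → ℝ) (hv : ∀ i, v i = 0 ∨ v i = 1)
    (hq : (M : ℝ) ≤ ∑ i : Fin b, 2 ^ (i : ℕ) * v i) :
    0 < LM b M α β v := by
  classical
  let f : Fin b → Bool := fun i => decide (v i = 1)
  have hf (i : Fin b) : v i = ((f i).toNat : ℝ) := by
    rcases hv i with h | h <;> simp [f, h]
  have hMq : M ≤ Nat.ofBits f := by
    rw [← sum_two_pow_mul_toNat_eq_ofBits, ← Nat.cast_le (α := ℝ)]
    push_cast
    simpa only [hf] using hq
  have hnonneg (i : Fin b) : 0 ≤ v i := by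
    rw [hf]; positivity
  refine add_pos_of_nonneg_of_pos (mul_nonneg hα (Finset.sum_nonneg fun i _ => ?_))
    (mul_pos hβ (Finset.sum_pos' (fun k _ => Finset.prod_nonneg fun i _ => hnonneg i)
      ⟨Nat.ofBits f, Finset.mem_Ico.mpr ⟨hMq, Nat.ofBits_lt_two_pow f⟩,
        Finset.prod_pos fun i hi => ?_⟩))
  · rcases hv i with h | h <;> simp [h]
  · have hbit : (Nat.ofBits f).testBit i = true := by
      rw [Nat.testBit_eq_decide_div_mod_eq]
      simpa using hi
    rw [Nat.testBit_ofBits_lt f i i.isLt] at hbit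
    have hvi : v i = 1 := by simpa [f] using hbit
    simp [hvi]
end

section
/- Let b be a positive integer, M an integer with 2^{b−1} < M ≤ 2^b, α, β ≥ 0, and let c_0, …, c_{2^b−1} ∈ ℝ be arbitrary real coefficients. Define H(v) := Σ_{k=0}^{2^b−1} c_k V_k(v) + L_M(v) on the cube [0,1]^b, where V_k(v) := ∏_{i=0}^{b−1} [k_i v_i + (1 − k_i)(1 − v_i)] and L_M(v) := α·Σ_{i=0}^{b−1} v_i(1 − v_i) + β·Σ_{k=M}^{2^b−1} ∏_{i : k_i = 1} v_i. Then H attains its minimum over [0,1]^b at some binary vector v* ∈ {0,1}^b; that is, there exists v* ∈ {0,1}^b with H(v*) ≤ H(v) for all v ∈ [0,1]^b. -/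
/-- `V_k(v) = ∏ᵢ [kᵢ vᵢ + (1 − kᵢ)(1 − vᵢ)]`, where `kᵢ = (k / 2^i) % 2` is the
i-th binary digit of `k`. -/
noncomputable def Vcoef (b k : ℕ) (v : Fin b → ℝ) : ℝ :=
  ∏ i : Fin b,
    (((k / 2 ^ (i : ℕ)) % 2 : ℕ) * v i + (1 - ((k / 2 ^ (i : ℕ)) % 2 : ℕ)) * (1 - v i))

/-- The modified embedded Hamiltonian `H(v) = Σ_k c_k V_k(v) + L_M(v)`. -/
noncomputable def Ham (b M : ℕ) (α β : ℝ) (c : ℕ → ℝ) (v : Fin b → ℝ) : ℝ :=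
  (∑ k ∈ Finset.range (2 ^ b), c k * Vcoef b k v) + LM b M α β v

open Function in
/-- On the line through `v` in direction `j`, a product of functions affine in one coordinate each
interpolates its values at the two endpoints. -/
theorem prod_eq_interpolate_update {ι : Type*} [DecidableEq ι] (s : Finset ι) (g : ι → ℝ → ℝ)
    (hg : ∀ i x, g i x = (1 - x) * g i 0 + x * g i 1) (v : ι → ℝ) (j : ι) :
    ∏ i ∈ s, g i (v i) = (1 - v j) * ∏ i ∈ s, g i (update v j 0 i) +
      v j * ∏ i ∈ s, g i (update v j 1 i) := by
  by_cases hj : j ∈ s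
  · have h_erase (t : ℝ) :
        ∏ i ∈ s.erase j, g i (update v j t i) = ∏ i ∈ s.erase j, g i (v i) :=
      Finset.prod_congr rfl fun i hi => by rw [update_of_ne (Finset.ne_of_mem_erase hi)]
    simp only [← Finset.mul_prod_erase s _ hj, h_erase, update_self]
    rw [hg j (v j)]
    ring
  · have h_const (t : ℝ) : ∏ i ∈ s, g i (update v j t i) = ∏ i ∈ s, g i (v i) :=
      Finset.prod_congr rfl fun i hi => by rw [update_of_ne (ne_of_mem_of_not_mem hi hj)]
    simp only [h_const]
    ring

open Function in
theorem Vcoef_eq_interpolate_update (b k : ℕ) (v : Fin b → ℝ) (j : Fin b) :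
    Vcoef b k v =
      (1 - v j) * Vcoef b k (update v j 0) + v j * Vcoef b k (update v j 1) :=
  prod_eq_interpolate_update Finset.univ
    (fun (i : Fin b) x =>
      ((k / 2 ^ (i : ℕ)) % 2 : ℕ) * x + (1 - ((k / 2 ^ (i : ℕ)) % 2 : ℕ)) * (1 - x))
    (fun i x => by ring) v j

open Function in
theorem interpolate_update_sum_mul_one_sub_le {ι : Type*} [Fintype ι] [DecidableEq ι]
    (v : ι → ℝ) (j : ι) (hv : v j ∈ Set.Icc (0 : ℝ) 1) :
    (1 - v j) * ∑ i, update v j 0 i * (1 - update v j 0 i) +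
      v j * ∑ i, update v j 1 i * (1 - update v j 1 i) ≤ ∑ i, v i * (1 - v i) := by
  have h_erase (t : ℝ) : ∑ i ∈ Finset.univ.erase j, update v j t i * (1 - update v j t i) =
      ∑ i ∈ Finset.univ.erase j, v i * (1 - v i) :=
    Finset.sum_congr rfl fun i hi => by rw [update_of_ne (Finset.ne_of_mem_erase hi)]
  simp only [← Finset.add_sum_erase Finset.univ _ (Finset.mem_univ j), h_erase, update_self]
  linarith [mul_nonneg hv.1 (sub_nonneg.2 hv.2)]

open Function in
theorem interpolate_update_LM_le (b M : ℕ) {α : ℝ} (β : ℝ) (hα : 0 ≤ α) (v : Fin b → ℝ)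
    (j : Fin b) (hv : v j ∈ Set.Icc (0 : ℝ) 1) :
    (1 - v j) * LM b M α β (update v j 0) + v j * LM b M α β (update v j 1) ≤
      LM b M α β v := by
  have h_concave :=
    mul_le_mul_of_nonneg_left (interpolate_update_sum_mul_one_sub_le v j hv) hα
  have h_affine : ∑ k ∈ Finset.Ico M (2 ^ b),
      ∏ i ∈ Finset.univ.filter (fun i : Fin b => (k / 2 ^ (i : ℕ)) % 2 = 1), v i =
      (1 - v j) * ∑ k ∈ Finset.Ico M (2 ^ b),
        ∏ i ∈ Finset.univ.filter (fun i : Fin b => (k / 2 ^ (i : ℕ)) % 2 = 1), update v j 0 i +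
      v j * ∑ k ∈ Finset.Ico M (2 ^ b),
        ∏ i ∈ Finset.univ.filter (fun i : Fin b => (k / 2 ^ (i : ℕ)) % 2 = 1),
          update v j 1 i := by
    rw [Finset.mul_sum, Finset.mul_sum, ← Finset.sum_add_distrib]
    exact Finset.sum_congr rfl fun k _ =>
      prod_eq_interpolate_update _ (fun _ x => x) (fun _ x => by ring) v j
  unfold LM
  rw [h_affine]
  linarith

open Function in
theorem interpolate_update_Ham_le (b M : ℕ) {α : ℝ} (β : ℝ) (hα : 0 ≤ α) (c : ℕ → ℝ)
    (v : Fin b → ℝ) (j : Fin b) (hv : v j ∈ Set.Icc (0 : ℝ) 1) :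
    (1 - v j) * Ham b M α β c (update v j 0) + v j * Ham b M α β c (update v j 1) ≤
      Ham b M α β c v := by
  have h_affine : ∑ k ∈ Finset.range (2 ^ b), c k * Vcoef b k v =
      (1 - v j) * ∑ k ∈ Finset.range (2 ^ b), c k * Vcoef b k (update v j 0) +
      v j * ∑ k ∈ Finset.range (2 ^ b), c k * Vcoef b k (update v j 1) := by
    rw [Finset.mul_sum, Finset.mul_sum, ← Finset.sum_add_distrib]
    refine Finset.sum_congr rfl fun k _ => ?_
    rw [Vcoef_eq_interpolate_update b k v j]
    ring
  have h_penalty := interpolate_update_LM_le b M β hα v j hv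
  unfold Ham
  rw [h_affine]
  linarith

open Function in
/-- A function on the unit cube lying above its interpolation along every coordinate direction
attains its minimum at a vertex. -/
theorem exists_binary_forall_le {ι : Type*} [Fintype ι] [DecidableEq ι] (f : (ι → ℝ) → ℝ)
    (hf : ∀ v j, v j ∈ Set.Icc (0 : ℝ) 1 →
      (1 - v j) * f (update v j 0) + v j * f (update v j 1) ≤ f v) :
    ∃ w : ι → ℝ, (∀ i, w i = 0 ∨ w i = 1) ∧
      ∀ v : ι → ℝ, (∀ i, v i ∈ Set.Icc (0 : ℝ) 1) → f w ≤ f v := by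
  have h_round (v : ι → ℝ) (hv : ∀ i, v i ∈ Set.Icc (0 : ℝ) 1) (s : Finset ι) :
      ∃ w : ι → ℝ, (∀ i, w i ∈ Set.Icc (0 : ℝ) 1) ∧ (∀ i ∈ s, w i = 0 ∨ w i = 1) ∧
        f w ≤ f v := by
    induction s using Finset.induction_on with
    | empty => exact ⟨v, hv, by simp, le_rfl⟩
    | insert j s _ ih =>
      obtain ⟨w, hw, hws, hwv⟩ := ih
      have h_update (t : ℝ) (ht : t = 0 ∨ t = 1) (hle : f (update w j t) ≤ f w) :
          ∃ w : ι → ℝ, (∀ i, w i ∈ Set.Icc (0 : ℝ) 1) ∧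
            (∀ i ∈ insert j s, w i = 0 ∨ w i = 1) ∧ f w ≤ f v := by
        refine ⟨update w j t, fun i => ?_, fun i hi => ?_, hle.trans hwv⟩
        · rcases eq_or_ne i j with rfl | hij
          · rcases ht with rfl | rfl <;> simp
          · rw [update_of_ne hij]
            exact hw i
        · rcases eq_or_ne i j with rfl | hij
          · rwa [update_self]
          · rw [update_of_ne hij]
            exact hws i (Finset.mem_of_mem_insert_of_ne hi hij)
      rcases le_or_gt (f (update w j 0)) (f w) with h0 | h0
      · exact h_update 0 (.inl rfl) h0
      · refine h_update 1 (.inr rfl) ?_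
        by_contra! h1
        have := hf w j (hw j)
        obtain ⟨hw0, hw1⟩ := hw j
        nlinarith [mul_nonneg (sub_nonneg.2 hw1) (sub_nonneg.2 h0.le),
          mul_nonneg hw0 (sub_nonneg.2 h1.le)]
  obtain ⟨p, hp⟩ := Finite.exists_min fun p : ι → Bool => f fun i => if p i then 1 else 0
  refine ⟨fun i => if p i then 1 else 0, fun i => (ite_eq_or_eq _ _ _).symm, fun v hv => ?_⟩
  obtain ⟨w, -, hw, hwv⟩ := h_round v hv Finset.univ
  have h_vertex : (fun i => if decide (w i = 1) then (1 : ℝ) else 0) = w := by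
    funext i
    rcases hw i (Finset.mem_univ i) with h | h <;> simp [h]
  have h_min := hp fun i => decide (w i = 1)
  rw [h_vertex] at h_min
  exact h_min.trans hwv

/-- the modified embedded Hamiltonian attains its minimum over the unit
cube at a binary (bang–bang) vector `v* ∈ {0,1}^b`. -/
theorem Ham_min_at_binary (b M : ℕ) (hb : 0 < b)
    (hM₁ : 2 ^ (b - 1) < M) (hM₂ : M ≤ 2 ^ b)
    (α β : ℝ) (hα : 0 ≤ α) (hβ : 0 ≤ β) (c : ℕ → ℝ) :
    ∃ v' : Fin b → ℝ, (∀ i, v' i = 0 ∨ v' i = 1) ∧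
      ∀ v : Fin b → ℝ, (∀ i, v i ∈ Set.Icc (0 : ℝ) 1) →
        Ham b M α β c v' ≤ Ham b M α β c v := by
  exact exists_binary_forall_le _ fun v j hv => interpolate_update_Ham_le b M β hα c v j hv
end
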